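/- For every real number t with 0 ≤ t < ∞ there exist an uncountable index set I and, for each i ∈ I, a finite alphabet Λᵢ and a nonperiodic Toeplitz sequence ηᵢ : ℤ → Λᵢ with associated Toeplitz flow (Xᵢ, Tᵢ), such that each Tᵢ has topological entropy t, and for all i ≠ j the systems (Xᵢ, Tᵢ) and (Xⱼ, Tⱼ) are not orbit equivalent: there is no homeomorphism F : Xᵢ → Xⱼ with F({Tᵢⁿx : n ∈ ℤ}) = {Tⱼⁿ(F x) : n ∈ ℤ} for all x ∈ Xᵢ. -/

import Mathlib

/-- A Toeplitz sequence: every position is periodic for some period `p ≥ 1`. -/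
def IsToeplitz {Λ : Type*} (η : ℤ → Λ) : Prop :=
  ∀ n : ℤ, ∃ p : ℤ, 1 ≤ p ∧ ∀ m : ℤ, η (n + m * p) = η n

/-- A sequence is nonperiodic if it has no global period `p ≥ 1`. -/
def IsNonperiodic {Λ : Type*} (η : ℤ → Λ) : Prop :=
  ¬ ∃ p : ℤ, 1 ≤ p ∧ ∀ n : ℤ, η (n + p) = η n

/-- The two-sided shift orbit of `η` in `Λ^ℤ`. -/
def shiftOrbit {Λ : Type*} (η : ℤ → Λ) : Set (ℤ → Λ) :=
  {x | ∃ n : ℤ, x = fun k => η (k + n)}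

/-- The shift homeomorphism on `Λ^ℤ`. -/
def shiftHomeo (Λ : Type*) [TopologicalSpace Λ] : (ℤ → Λ) ≃ₜ (ℤ → Λ) where
  toFun x := fun k => x (k + 1)
  invFun x := fun k => x (k - 1)
  left_inv x := by funext k; simp
  right_inv x := by funext k; simp
  continuous_toFun := continuous_pi fun k => continuous_apply (k + 1)
  continuous_invFun := continuous_pi fun k => continuous_apply (k - 1)

/-- The phase space of the Toeplitz flow of `η`: the orbit closure of `η`. -/
def toeplitzX {Λ : Type*} [TopologicalSpace Λ] (η : ℤ → Λ) : Set (ℤ → Λ) :=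
  closure (shiftOrbit η)

lemma shiftHomeo_image_orbit {Λ : Type*} [TopologicalSpace Λ] (η : ℤ → Λ) :
    shiftHomeo Λ '' shiftOrbit η = shiftOrbit η := by
  ext x
  constructor
  · rintro ⟨y, ⟨n, rfl⟩, rfl⟩
    exact ⟨n + 1, by funext k; show η (k + 1 + n) = η (k + (n + 1)); ring_nf⟩
  · rintro ⟨n, rfl⟩
    refine ⟨fun k => η (k + (n - 1)), ⟨n - 1, rfl⟩, ?_⟩
    funext k; show η (k + 1 + (n - 1)) = η (k + n); ring_nf

lemma shiftHomeo_image_toeplitzX {Λ : Type*} [TopologicalSpace Λ] (η : ℤ → Λ) :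
    shiftHomeo Λ '' toeplitzX η = toeplitzX η := by
  rw [toeplitzX, Homeomorph.image_closure, shiftHomeo_image_orbit]

/-- The Toeplitz flow transformation: the shift restricted to the orbit
closure of `η`. -/
def toeplitzT {Λ : Type*} [TopologicalSpace Λ] (η : ℤ → Λ) :
    ↥(toeplitzX η) ≃ₜ ↥(toeplitzX η) :=
  ((shiftHomeo Λ).image (toeplitzX η)).trans
    (Homeomorph.setCongr (shiftHomeo_image_toeplitzX η))

/-- A Toeplitz flow: a nonperiodic Toeplitz sequence over a finite nonempty
alphabet (with the discrete uniformity/topology), together with the orbit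
closure dynamics. -/
structure ToeplitzFlow : Type 1 where
  Λ : Type
  [fin : Fintype Λ]
  [nonempty : Nonempty Λ]
  η : ℤ → Λ
  toeplitz : IsToeplitz η
  nonperiodic : IsNonperiodic η

attribute [instance] ToeplitzFlow.fin ToeplitzFlow.nonempty

noncomputable instance (F : ToeplitzFlow) : UniformSpace F.Λ := ⊥

instance (F : ToeplitzFlow) : DiscreteTopology F.Λ := by
  constructor
  change UniformSpace.toTopologicalSpace = ⊥
  exact UniformSpace.toTopologicalSpace_bot

/-- The phase space of a Toeplitz flow. -/
abbrev ToeplitzFlow.X (F : ToeplitzFlow) : Type := ↥(toeplitzX F.η)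

/-- The transformation of a Toeplitz flow (the restricted shift). -/
noncomputable def ToeplitzFlow.T (F : ToeplitzFlow) : F.X ≃ₜ F.X := toeplitzT F.η

/-- The topological entropy (Bowen–Dinaburg cover entropy, with respect to the
canonical uniformity of the compact metrizable space `F.X`) of a Toeplitz flow. -/
noncomputable def ToeplitzFlow.entropy (F : ToeplitzFlow) : EReal :=
  Dynamics.coverEntropy (F.T : F.X → F.X) Set.univ

/-- The full (two-sided) orbit of `x` under the homeomorphism `T`. -/
def homeoOrbit {X : Type*} [TopologicalSpace X] (T : X ≃ₜ X) (x : X) : Set X :=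
  Set.range fun n : ℤ => (T.toEquiv ^ n) x

/-- Orbit equivalence of two homeomorphic dynamical systems. -/
def OrbitEquiv {X Y : Type*} [TopologicalSpace X] [TopologicalSpace Y]
    (T : X ≃ₜ X) (S : Y ≃ₜ Y) : Prop :=
  ∃ e : X ≃ₜ Y, ∀ x : X, e '' homeoOrbit T x = homeoOrbit S (e x)

open MeasureTheory Filter Topology

/-- **Krylov–Bogoliubov**: a continuous self-map of a nonempty compact metrizable space
preserves some Borel probability measure. -/
theorem exists_invariant_probabilityMeasure {X : Type*} [TopologicalSpace X] [CompactSpace X]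
    [T2Space X] [SecondCountableTopology X] [Nonempty X] [MeasurableSpace X] [BorelSpace X]
    {T : X → X} (hT : Continuous T) :
    ∃ μ : Measure X, IsProbabilityMeasure μ ∧ μ.map T = μ := by
  obtain ⟨x⟩ := ‹Nonempty X›
  let ν (n : ℕ) : Measure X :=
    ((n + 1 : ℕ) : ENNReal)⁻¹ • ∑ k ∈ Finset.range (n + 1), Measure.dirac (T^[k] x)
  have hν (n : ℕ) : IsProbabilityMeasure (ν n) := by
    constructor
    simp only [ν, Measure.smul_apply, Measure.finsetSum_apply, measure_univ, Finset.sum_const,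
      Finset.card_range, nsmul_eq_mul, mul_one, smul_eq_mul]
    exact ENNReal.inv_mul_cancel (by simp) (ENNReal.natCast_ne_top _)
  let P (n : ℕ) : ProbabilityMeasure X := ⟨ν n, hν n⟩
  let U : Ultrafilter ℕ := hyperfilter ℕ
  obtain ⟨μ, -, hμ⟩ := (isCompact_univ (X := ProbabilityMeasure X)).ultrafilter_le_nhds
    (U.map P) (by simp)
  have hlim : Tendsto P U (𝓝 μ) := hμ
  rw [ProbabilityMeasure.tendsto_iff_forall_integral_tendsto] at hlim
  have hinteg (n : ℕ) (f : BoundedContinuousFunction X ℝ) :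
      ∫ y, f y ∂(P n : Measure X) =
        ((n + 1 : ℕ) : ℝ)⁻¹ * ∑ k ∈ Finset.range (n + 1), f (T^[k] x) := by
    change ∫ y, f y ∂(ν n) = _
    simp only [ν]
    rw [integral_smul_measure, integral_finsetSum_measure]
    · rw [ENNReal.toReal_inv, ENNReal.toReal_natCast]
      simp
    · intro i _
      exact f.integrable _
  refine ⟨μ, inferInstance, ?_⟩
  have : IsProbabilityMeasure ((μ : Measure X).map T) :=
    Measure.isProbabilityMeasure_map hT.aemeasurable
  refine ext_of_forall_integral_eq_of_IsFiniteMeasure fun f => ?_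
  rw [integral_map hT.aemeasurable f.continuous.aestronglyMeasurable]
  let g := f.compContinuous ⟨T, hT⟩
  have h1 := hlim f
  have h2 := hlim g
  have h3 : Tendsto (fun n => ∫ y, g y ∂(P n : Measure X) - ∫ y, f y ∂(P n : Measure X))
      U (𝓝 0) := by
    have hle : (U : Filter ℕ) ≤ atTop := Nat.hyperfilter_le_atTop
    refine Tendsto.mono_left ?_ hle
    refine squeeze_zero_norm (a := fun n : ℕ => (2 * ‖f‖) / ((n : ℝ) + 1)) (fun n => ?_) ?_
    · rw [hinteg, hinteg, ← mul_sub, ← Finset.sum_sub_distrib]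
      have : ∑ k ∈ Finset.range (n + 1), (g (T^[k] x) - f (T^[k] x)) =
          f (T^[n + 1] x) - f (T^[0] x) := by
        rw [← Finset.sum_range_sub (fun k => f (T^[k] x))]
        refine Finset.sum_congr rfl fun k _ => ?_
        rw [Function.iterate_succ_apply']
        rfl
      rw [this, norm_mul, norm_inv, div_eq_inv_mul]
      have e1 := f.norm_coe_le_norm (T^[n + 1] x)
      have e2 := f.norm_coe_le_norm (T^[0] x)
      have e3 := norm_sub_le (f (T^[n + 1] x)) (f (T^[0] x))
      have e4 : ‖((n + 1 : ℕ) : ℝ)‖ = (n : ℝ) + 1 := by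
        rw [Real.norm_natCast]; push_cast; rfl
      rw [e4]
      gcongr
      linarith
    · exact tendsto_const_nhds.div_atTop
        (tendsto_atTop_add_const_right _ _ tendsto_natCast_atTop_atTop)
  have h4 := tendsto_nhds_unique (h2.sub h1) h3
  exact sub_eq_zero.mp h4

/-- The integer powers of a measure-preserving homeomorphism are measure-preserving
homeomorphisms. -/
theorem exists_homeomorph_zpow {X : Type*} [TopologicalSpace X] [MeasurableSpace X]
    [BorelSpace X] {T : X ≃ₜ X} {μ : Measure X} (hμ : μ.map T = μ) (n : ℤ) :
    ∃ h : X ≃ₜ X, (∀ x, h x = (T.toEquiv ^ n) x) ∧ μ.map h = μ := by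
  have hsymm : μ.map T.symm = μ := by
    conv_lhs => rw [← hμ]
    rw [Measure.map_map T.symm.continuous.measurable T.continuous.measurable]
    simp
  induction n with
  | zero => exact ⟨Homeomorph.refl X, fun x => rfl, Measure.map_id⟩
  | succ n ih =>
    obtain ⟨h, hh, hm⟩ := ih
    refine ⟨T.trans h, fun x => ?_, ?_⟩
    · rw [zpow_add_one]; exact hh (T x)
    · change μ.map (h ∘ T) = μ
      rw [← Measure.map_map h.continuous.measurable T.continuous.measurable, hμ, hm]
  | pred n ih =>
    obtain ⟨h, hh, hm⟩ := ih
    refine ⟨T.symm.trans h, fun x => ?_, ?_⟩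
    · rw [zpow_sub_one]; exact hh (T.symm x)
    · change μ.map (h ∘ T.symm) = μ
      rw [← Measure.map_map h.continuous.measurable T.symm.continuous.measurable, hsymm, hm]

/-- A homeomorphism moving points inside the orbits of a measure-preserving homeomorphism
preserves the measure. -/
theorem map_eq_of_mem_homeoOrbit {X : Type*} [TopologicalSpace X] [T2Space X]
    [MeasurableSpace X] [BorelSpace X] {T R : X ≃ₜ X} (hR : ∀ x, R x ∈ homeoOrbit T x)
    {μ : Measure X} (hμ : μ.map T = μ) : μ.map R = μ := by
  choose P hP hPμ using exists_homeomorph_zpow hμ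
  have himg (n : ℤ) (A : Set X) (hA : MeasurableSet A) : μ (P n '' A) = μ A := by
    have hm : MeasurableSet (P n '' A) := (P n).toMeasurableEquiv.measurableSet_image.mpr hA
    conv_lhs => rw [← hPμ n]
    rw [Measure.map_apply (P n).continuous.measurable hm, (P n).injective.preimage_image]
  let e : ℕ ≃ ℤ := Equiv.intEquivNat.symm
  let D : ℕ → Set X := disjointed fun k => {x | R x = P (e k) x}
  have hDm (k : ℕ) : MeasurableSet (D k) :=
    MeasurableSet.disjointed
      (fun k => (isClosed_eq R.continuous (P (e k)).continuous).measurableSet) k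
  have hDu : ⋃ k, D k = Set.univ := by
    rw [iUnion_disjointed]
    refine Set.eq_univ_of_forall fun x => ?_
    obtain ⟨n, hn⟩ := hR x
    refine Set.mem_iUnion.mpr ⟨e.symm n, ?_⟩
    change R x = P (e (e.symm n)) x
    rw [e.apply_symm_apply, hP]
    exact hn.symm
  have hDd : Pairwise (Function.onFun Disjoint D) := disjoint_disjointed _
  ext A hA
  rw [Measure.map_apply R.continuous.measurable hA]
  set B := R ⁻¹' A with hB
  have hBm : MeasurableSet B := R.continuous.measurable hA
  have hAB : A = R '' B := (Set.image_preimage_eq A R.surjective).symm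
  have h1 : B = ⋃ k, B ∩ D k := by rw [← Set.inter_iUnion, hDu, Set.inter_univ]
  have h2 : A = ⋃ k, R '' (B ∩ D k) := by rw [← Set.image_iUnion, ← h1, hAB]
  have h3 (k : ℕ) : R '' (B ∩ D k) = P (e k) '' (B ∩ D k) :=
    Set.image_congr fun x hx => disjointed_subset _ k hx.2
  have hd : Pairwise (Function.onFun Disjoint fun k => B ∩ D k) := fun i j hij =>
    (hDd hij).mono Set.inter_subset_right Set.inter_subset_right
  conv_lhs => rw [h1]
  conv_rhs => rw [h2]
  rw [measure_iUnion hd fun k => hBm.inter (hDm k), measure_iUnion]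
  · refine tsum_congr fun k => ?_
    rw [h3, himg _ _ (hBm.inter (hDm k))]
  · exact fun i j hij => (Set.disjoint_image_iff R.injective).mpr (hd hij)
  · exact fun k => R.toMeasurableEquiv.measurableSet_image.mpr (hBm.inter (hDm k))

/-- The values taken by all invariant probability measures simultaneously on some clopen set. -/
def clopenValues {X : Type*} [TopologicalSpace X] (T : X ≃ₜ X) : Set ENNReal :=
  {r | ∃ U : Set X, IsClopen U ∧ ∀ μ : @Measure X (borel X),
    @IsProbabilityMeasure X (borel X) μ → @Measure.map X X (borel X) (borel X) T μ = μ → μ U = r}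

theorem countable_clopenValues {X : Type*} [TopologicalSpace X] [CompactSpace X] [T2Space X]
    [SecondCountableTopology X] [TotallyDisconnectedSpace X] [Nonempty X] (T : X ≃ₜ X) :
    (clopenValues T).Countable := by
  let _ : MeasurableSpace X := borel X
  have : BorelSpace X := ⟨rfl⟩
  obtain ⟨μ, hμ, hT⟩ := exists_invariant_probabilityMeasure T.continuous
  have : Countable (TopologicalSpace.Clopens X) :=
    TopologicalSpace.Clopens.countable_iff_secondCountable.mpr inferInstance
  refine (Set.countable_range fun U : TopologicalSpace.Clopens X => μ (U : Set X)).mono ?_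
  rintro r ⟨U, hU, h⟩
  exact ⟨⟨U, hU⟩, h μ hμ hT⟩

theorem OrbitEquiv.symm {X Y : Type*} [TopologicalSpace X] [TopologicalSpace Y]
    {T : X ≃ₜ X} {S : Y ≃ₜ Y} (h : OrbitEquiv T S) : OrbitEquiv S T := by
  obtain ⟨e, he⟩ := h
  refine ⟨e.symm, fun y => ?_⟩
  have := he (e.symm y)
  rw [e.apply_symm_apply] at this
  rw [← this, Set.image_image]
  simp

theorem OrbitEquiv.clopenValues_subset {X Y : Type*} [TopologicalSpace X] [TopologicalSpace Y]
    [T2Space X] {T : X ≃ₜ X} {S : Y ≃ₜ Y} (h : OrbitEquiv T S) :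
    clopenValues T ⊆ clopenValues S := by
  obtain ⟨e, he⟩ := h
  rintro r ⟨U, hU, hr⟩
  let _ : MeasurableSpace X := borel X
  have : BorelSpace X := ⟨rfl⟩
  let _ : MeasurableSpace Y := borel Y
  have : BorelSpace Y := ⟨rfl⟩
  refine ⟨e.symm ⁻¹' U, hU.preimage e.symm.continuous, fun ν hν hS => ?_⟩
  let R : X ≃ₜ X := (e.trans S).trans e.symm
  have hm : (ν.map e.symm).map R = ν.map e.symm := by
    rw [Measure.map_map R.continuous.measurable e.symm.continuous.measurable]
    have : (R : X → X) ∘ e.symm = e.symm ∘ S := by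
      funext y; simp [R]
    rw [this, ← Measure.map_map e.symm.continuous.measurable S.continuous.measurable, hS]
  have hmem (x : X) : T x ∈ homeoOrbit R x := by
    obtain ⟨n, hn⟩ := he x ▸ Set.mem_image_of_mem e (show T x ∈ homeoOrbit T x from ⟨1, rfl⟩)
    refine ⟨n, ?_⟩
    have hconj : R.toEquiv = e.toEquiv.symm.permCongrHom S.toEquiv := by ext y; rfl
    change (R.toEquiv ^ n) x = T x
    rw [hconj, ← map_zpow]
    change e.symm ((S.toEquiv ^ n) (e x)) = T x
    rw [e.symm_apply_eq]
    exact hn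
  have hT := map_eq_of_mem_homeoOrbit hmem hm
  rw [← Measure.map_apply e.symm.continuous.measurable hU.isOpen.measurableSet]
  exact hr _ (Measure.isProbabilityMeasure_map e.symm.continuous.aemeasurable) hT

theorem OrbitEquiv.clopenValues_eq {X Y : Type*} [TopologicalSpace X] [TopologicalSpace Y]
    [T2Space X] [T2Space Y] {T : X ≃ₜ X} {S : Y ≃ₜ Y} (h : OrbitEquiv T S) :
    clopenValues T = clopenValues S :=
  h.clopenValues_subset.antisymm h.symm.clopenValues_subset

/-- The number of words of length `L` in `x` is `O(exp (h * L))`. -/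
def WordGrowthLE {Λ : Type*} (x : ℤ → Λ) (h : ℝ) : Prop :=
  ∃ C : ℝ, ∀ L : ℕ, ∃ S : Finset (ℕ → Λ), (S.card : ℝ) ≤ C * Real.exp (h * L) ∧
    ∀ k : ℤ, ∃ w ∈ S, ∀ i < L, x (k + i) = w i

/-- For infinitely many lengths `n`, at least `exp (h * n)` different words of length `n`
occur in `x`. -/
def WordGrowthGE {Λ : Type*} (x : ℤ → Λ) (h : ℝ) : Prop :=
  ∃ᶠ n : ℕ in atTop, ∃ P : Finset ℤ, Real.exp (h * n) ≤ P.card ∧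
    ∀ k ∈ P, ∀ l ∈ P, (∀ i < n, x (k + i) = x (l + i)) → k = l

namespace ToeplitzFlow

variable (F : ToeplitzFlow)

lemma T_apply (x : F.X) (k : ℤ) : (F.T x).1 k = x.1 (k + 1) := rfl

lemma T_iterate_apply (x : F.X) (n : ℕ) (k : ℤ) : (F.T^[n] x).1 k = x.1 (k + n) := by
  induction n generalizing x with
  | zero => simp
  | succ n ih =>
    rw [Function.iterate_succ_apply, ih, T_apply]
    push_cast
    ring_nf

/-- The point of the flow obtained by shifting the defining sequence. -/
def shiftPt (n : ℤ) : F.X := ⟨fun k => F.η (k + n), subset_closure ⟨n, rfl⟩⟩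

instance : Nonempty F.X := ⟨F.shiftPt 0⟩

lemma exists_agree (x : F.X) (a : ℤ) (L : ℕ) :
    ∃ k : ℤ, ∀ i < L, x.1 (a + i) = F.η (k + i) := by
  let s : Finset ℤ := (Finset.range L).image fun i : ℕ => a + (i : ℤ)
  let V : Set (ℤ → F.Λ) := (s : Set ℤ).pi fun k => {x.1 k}
  have hV : IsOpen V := isOpen_set_pi s.finite_toSet fun k _ => isOpen_discrete _
  obtain ⟨y, hyV, n, rfl⟩ := mem_closure_iff.mp x.2 V hV fun k _ => rfl
  refine ⟨a + n, fun i hi => ?_⟩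
  have := hyV (a + i) (Finset.mem_coe.mpr
    (Finset.mem_image.mpr ⟨i, Finset.mem_range.mpr hi, rfl⟩))
  rw [Set.mem_singleton_iff] at this
  rw [← this]
  ring_nf

lemma exists_window_of_mem_uniformity {V : Set (F.X × F.X)} (hV : V ∈ uniformity F.X) :
    ∃ m : ℕ, ∀ x y : F.X, (∀ k : ℤ, -m ≤ k → k ≤ m → x.1 k = y.1 k) → (x, y) ∈ V := by
  rw [uniformity_subtype, mem_comap] at hV
  obtain ⟨W, hW, hWV⟩ := hV
  rw [Pi.uniformity, mem_iInf] at hW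
  obtain ⟨I, hI, Z, hZ, rfl⟩ := hW
  obtain ⟨m, hm⟩ := (hI.image Int.natAbs).bddAbove
  refine ⟨m, fun x y hxy => hWV ?_⟩
  simp only [Set.mem_preimage, Set.mem_iInter]
  intro i
  obtain ⟨Y, hY, hYZ⟩ := mem_comap.mp (hZ i)
  have hi : (i : ℤ).natAbs ≤ m := hm ⟨i, i.2, rfl⟩
  have h := hxy i (by omega) (by omega)
  refine hYZ ?_
  simp only [Set.mem_preimage]
  rw [h]
  exact refl_mem_uniformity hY

lemma coord_mem_uniformity : {p : F.X × F.X | p.1.1 0 = p.2.1 0} ∈ uniformity F.X := by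
  have h : UniformContinuous fun x : F.X => x.1 0 :=
    (Pi.uniformContinuous_proj _ 0).comp uniformContinuous_subtype_val
  have h2 : {p : F.Λ × F.Λ | p.1 = p.2} ∈ uniformity F.Λ := by
    change _ ∈ 𝓟 _
    exact mem_principal.mpr fun p hp => hp
  exact h h2

theorem entropy_le {h : ℝ} (hh : WordGrowthLE F.η h) : F.entropy ≤ (h : EReal) := by
  classical
  obtain ⟨C, hC⟩ := hh
  refine iSup₂_le fun V hV => ?_
  obtain ⟨m, hm⟩ := F.exists_window_of_mem_uniformity hV
  rw [← ExpGrowth.expGrowthSup_exp (a := (h : EReal))]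
  refine ExpGrowth.expGrowthSup_le_of_eventually_le
    (b := ENNReal.ofReal (C * Real.exp (h * (2 * m + 1)))) ENNReal.ofReal_ne_top
    (Eventually.of_forall fun n => ?_)
  obtain ⟨S, hScard, hS⟩ := hC (n + (2 * m + 1))
  have hcov (x : F.X) : ∃ w ∈ S, ∀ i < n + (2 * m + 1), x.1 (-m + i) = w i := by
    obtain ⟨k, hk⟩ := F.exists_agree x (-m) (n + (2 * m + 1))
    obtain ⟨w, hw, hkw⟩ := hS k
    exact ⟨w, hw, fun i hi => (hk i hi).trans (hkw i hi)⟩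
  let g (w : ℕ → F.Λ) : F.X :=
    if hw : ∃ x : F.X, ∀ i < n + (2 * m + 1), x.1 (-m + i) = w i then hw.choose else F.shiftPt 0
  have hdyn : Dynamics.IsDynCoverOf F.T Set.univ V n (S.image g : Finset F.X) := by
    intro x _
    obtain ⟨w, hw, hxw⟩ := hcov x
    have hex : ∃ x : F.X, ∀ i < n + (2 * m + 1), x.1 (-m + i) = w i := ⟨x, hxw⟩
    refine ⟨g w, Finset.mem_coe.mpr (Finset.mem_image_of_mem g hw), ?_⟩
    have hg : ∀ i < n + (2 * m + 1), (g w).1 (-m + i) = w i := by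
      simp only [g, dif_pos hex]
      exact hex.choose_spec
    rw [Dynamics.mem_dynEntourage]
    intro k hk
    refine hm _ _ fun j hj1 hj2 => ?_
    rw [T_iterate_apply, T_iterate_apply]
    obtain ⟨i, hi⟩ : ∃ i : ℕ, j + k = -m + i := ⟨(j + k + m).toNat, by omega⟩
    rw [hi, hxw i (by omega), hg i (by omega)]
  have hle : (Dynamics.coverMincard F.T Set.univ V n : ENNReal) ≤ ((S.card : ℕ) : ENNReal) := by
    have := hdyn.coverMincard_le_card
    have h2 : Dynamics.coverMincard F.T Set.univ V n ≤ (S.card : ℕ∞) :=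
      this.trans (by exact_mod_cast Finset.card_image_le)
    have h3 := ENat.toENNReal_mono h2
    simpa using h3
  refine hle.trans ?_
  have hcast : ((h : EReal) * (n : EReal)) = ((h * n : ℝ) : EReal) := by push_cast; rfl
  rw [hcast, EReal.exp_coe, ← ENNReal.ofReal_mul' (Real.exp_nonneg _), ← ENNReal.ofReal_natCast]
  refine ENNReal.ofReal_le_ofReal (hScard.trans (le_of_eq ?_))
  rw [mul_assoc, ← Real.exp_add]
  push_cast
  ring_nf

theorem le_entropy {h : ℝ} (hh : WordGrowthGE F.η h) : (h : EReal) ≤ F.entropy := by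
  classical
  refine le_trans ?_ (Dynamics.coverEntropyEntourage_le_coverEntropy _ _ F.coord_mem_uniformity)
  refine Frequently.le_expGrowthSup (hh.mono ?_)
  rintro n ⟨P, hP, hinj⟩
  have hcast : ((h : EReal) * (n : EReal)) = ((h * n : ℝ) : EReal) := by push_cast; rfl
  rw [hcast, EReal.exp_coe]
  have hcard : (P.card : ℕ∞) ≤
      Dynamics.coverMincard F.T Set.univ {p : F.X × F.X | p.1.1 0 = p.2.1 0} n := by
    refine le_iInf₂ fun s hs => ?_
    have hs' (k : ℤ) : ∃ y ∈ s, ∀ i < n, F.η (k + i) = y.1 i := by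
      obtain ⟨y, hy, hyk⟩ := hs (Set.mem_univ (F.shiftPt k))
      refine ⟨y, hy, fun i hi => ?_⟩
      have := Dynamics.mem_dynEntourage.mp hyk i hi
      simp only [Set.mem_ofPred_eq, T_iterate_apply, zero_add] at this
      rw [← this, add_comm]
      rfl
    choose y hy hyk using hs'
    have : P.card ≤ s.card := by
      refine Finset.card_le_card_of_injOn y (fun k _ => hy k) fun k hk l hl hkl => ?_
      exact hinj k hk l hl fun i hi => by rw [hyk k i hi, hyk l i hi, hkl]
    exact_mod_cast this
  have h3 := ENat.toENNReal_mono hcard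
  refine le_trans ?_ h3
  rw [ENat.toENNReal_coe, ← ENNReal.ofReal_natCast]
  exact ENNReal.ofReal_le_ofReal hP

end ToeplitzFlow

theorem wordGrowthLE_of_blocks {Λ : Type*} {x : ℤ → Λ} {p M : ℕ} (hp : 0 < p) (hM : 0 < M)
    (a : ℤ) (W : ℕ → ℕ → Λ)
    (hW : ∀ m : ℤ, ∃ c < M, ∀ i < p, x (a + m * p + i) = W c i) :
    WordGrowthLE x (Real.log M / p) := by
  classical
  refine ⟨p * M ^ 2, fun L => ?_⟩
  choose c hcM hc using hW
  let g (z : Fin p × (Fin (L / p + 2) → Fin M)) (i : ℕ) : Λ :=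
    if hi : (z.1 + i) / p < L / p + 2 then W (z.2 ⟨_, hi⟩) ((z.1 + i) % p) else W 0 0
  refine ⟨Finset.univ.image g, ?_, fun k => ?_⟩
  · have h1 : (Finset.univ.image g).card ≤ p * M ^ (L / p + 2) :=
      Finset.card_image_le.trans (by simp)
    have hpR : (0 : ℝ) < p := by exact_mod_cast hp
    have hMR : (0 : ℝ) < M := by exact_mod_cast hM
    have hlog : 0 ≤ Real.log M := Real.log_natCast_nonneg M
    have h2 : (M : ℝ) ^ (L / p) ≤ Real.exp (Real.log M / p * L) := by
      rw [← Real.exp_log (pow_pos hMR _), Real.log_pow, Real.exp_le_exp, div_mul_eq_mul_div,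
        mul_div_assoc, mul_comm]
      exact mul_le_mul_of_nonneg_left Nat.cast_div_le hlog
    calc ((Finset.univ.image g).card : ℝ) ≤ ((p * M ^ (L / p + 2) : ℕ) : ℝ) := by
          exact_mod_cast h1
      _ = p * M ^ 2 * (M : ℝ) ^ (L / p) := by push_cast; ring
      _ ≤ _ := by gcongr
  · have hpZ : (0 : ℤ) < p := by exact_mod_cast hp
    obtain ⟨r, hr⟩ := Int.eq_ofNat_of_zero_le (Int.emod_nonneg (k - a) hpZ.ne')
    have hrp : r < p := by
      have := Int.emod_lt_of_pos (k - a) hpZ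
      omega
    have hk : k = a + (k - a) / p * p + r := by
      have := Int.mul_ediv_add_emod (k - a) p
      rw [hr] at this
      linarith
    refine ⟨g (⟨r, hrp⟩, fun j => ⟨c ((k - a) / p + (j : ℕ)), hcM _⟩),
      Finset.mem_image_of_mem g (Finset.mem_univ _), fun i hi => ?_⟩
    have hlt : (r + i) / p < L / p + 2 := by
      have h1 : (r + i) / p ≤ (L + p) / p := Nat.div_le_div_right (by omega)
      rw [Nat.add_div_right _ hp] at h1
      omega
    simp only [g, dif_pos hlt]
    rw [← hc _ _ (Nat.mod_lt _ hp)]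
    congr 1
    have h2 : ((r : ℤ) + i) = p * (((r + i) / p : ℕ) : ℤ) + (((r + i) % p : ℕ) : ℤ) := by
      exact_mod_cast (Nat.div_add_mod (r + i) p).symm
    conv_lhs => rw [hk]
    linear_combination h2

theorem WordGrowthLE.prodMk {Λ Λ' : Type*} {x : ℤ → Λ} {y : ℤ → Λ'} {h h' : ℝ}
    (hx : WordGrowthLE x h) (hy : WordGrowthLE y h') :
    WordGrowthLE (fun k => (x k, y k)) (h + h') := by
  classical
  obtain ⟨C, hC⟩ := hx
  obtain ⟨C', hC'⟩ := hy
  refine ⟨C * C', fun L => ?_⟩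
  obtain ⟨S, hS, hSx⟩ := hC L
  obtain ⟨S', hS', hSy⟩ := hC' L
  refine ⟨(S ×ˢ S').image fun z i => (z.1 i, z.2 i), ?_, fun k => ?_⟩
  · calc (((S ×ˢ S').image fun z (i : ℕ) => (z.1 i, z.2 i)).card : ℝ)
        ≤ ((S.card * S'.card : ℕ) : ℝ) := by
          rw [← Finset.card_product]
          exact_mod_cast Finset.card_image_le
      _ = S.card * S'.card := by push_cast; rfl
      _ ≤ (C * Real.exp (h * L)) * (C' * Real.exp (h' * L)) :=
          mul_le_mul hS hS' (Nat.cast_nonneg _) ((Nat.cast_nonneg _).trans hS)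
      _ = _ := by rw [add_mul, Real.exp_add]; ring
  · obtain ⟨w, hw, hwx⟩ := hSx k
    obtain ⟨w', hw', hwy⟩ := hSy k
    exact ⟨_, Finset.mem_image_of_mem _ (Finset.mk_mem_product hw hw'),
      fun i hi => Prod.ext (hwx i hi) (hwy i hi)⟩

theorem WordGrowthGE.prodMk {Λ Λ' : Type*} {x : ℤ → Λ} {h : ℝ} (hx : WordGrowthGE x h)
    (y : ℤ → Λ') : WordGrowthGE (fun k => (x k, y k)) h :=
  hx.mono fun _ ⟨P, hP, hinj⟩ => ⟨P, hP, fun k hk l hl hkl =>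
    hinj k hk l hl fun i hi => congrArg Prod.fst (hkl i hi)⟩

theorem IsToeplitz.prodMk {Λ Λ' : Type*} {x : ℤ → Λ} {y : ℤ → Λ'} (hx : IsToeplitz x)
    (hy : IsToeplitz y) : IsToeplitz fun k => (x k, y k) := by
  intro n
  obtain ⟨p, hp, hxp⟩ := hx n
  obtain ⟨q, hq, hyq⟩ := hy n
  refine ⟨p * q, one_le_mul_of_one_le_of_one_le hp hq, fun m => Prod.ext ?_ ?_⟩
  · have := hxp (m * q)
    rwa [mul_assoc, mul_comm q p] at this
  · have := hyq (m * p)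
    rwa [mul_assoc] at this

theorem IsNonperiodic.prodMk {Λ Λ' : Type*} (x : ℤ → Λ) {y : ℤ → Λ'} (hy : IsNonperiodic y) :
    IsNonperiodic fun k => (x k, y k) :=
  fun ⟨p, hp, h⟩ => hy ⟨p, hp, fun n => congrArg Prod.snd (h n)⟩

/-- Parameters of a hierarchy of blocks: there are `M n` blocks of length `p n` at level `n`, and a
block of level `n + 1` is a concatenation of `s n` fixed and `u n` arbitrary blocks of level `n`. -/
structure BlockHierarchy (A : ℕ) where
  p : ℕ → ℕ
  M : ℕ → ℕ
  s : ℕ → ℕ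
  u : ℕ → ℕ
  p_zero : p 0 = 1
  M_zero : M 0 = A + 1
  p_succ : ∀ n, p (n + 1) = p n * (s n + u n)
  M_succ : ∀ n, M (n + 1) = M n ^ u n
  two_le_M : ∀ n, 2 ≤ M n
  M_add_three_le_s : ∀ n, M n + 3 ≤ s n

theorem Nat.eq_of_forall_div_pow_mod_eq {M : ℕ} (u : ℕ) {c d : ℕ} (hc : c < M ^ u)
    (hd : d < M ^ u) (h : ∀ j < u, c / M ^ j % M = d / M ^ j % M) : c = d := by
  induction u generalizing c d with
  | zero => simp at hc hd; omega
  | succ u ih =>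
    have h0 := h 0 (by omega)
    simp only [pow_zero, Nat.div_one] at h0
    rw [pow_succ] at hc hd
    have h1 : c / M = d / M := by
      refine ih (Nat.div_lt_of_lt_mul (by rwa [mul_comm])) (Nat.div_lt_of_lt_mul (by rwa [mul_comm]))
        fun j hj => ?_
      have := h (j + 1) (by omega)
      rwa [Nat.div_div_eq_div_mul, Nat.div_div_eq_div_mul, ← pow_succ']
    rw [← Nat.div_add_mod c M, ← Nat.div_add_mod d M, h0, h1]

namespace BlockHierarchy

variable {A : ℕ} (D : BlockHierarchy A)

/-- The block of level `n` with code `c`. -/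
def word : ℕ → ℕ → ℕ → Fin (A + 1)
  | 0, c, _ => Fin.ofNat (A + 1) c
  | n + 1, c, i =>
    word n (if i / D.p n < D.s n then i / D.p n % D.M n
      else c / D.M n ^ (i / D.p n - D.s n) % D.M n) (i % D.p n)

/-- Minus the left endpoint of the central block of level `n`. -/
def offset : ℕ → ℤ
  | 0 => 0
  | n + 1 => offset n + D.p n

/-- The position `k` belongs to the central block of level `n`. -/
def Central (n : ℕ) (k : ℤ) : Prop := 0 ≤ k + D.offset n ∧ k + D.offset n < D.p n

/-- The sequence all of whose central blocks have code `1`. -/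
def seq (k : ℤ) : Fin (A + 1) := D.word k.natAbs 1 (k + D.offset k.natAbs).toNat

lemma p_pos (n : ℕ) : 0 < D.p n := by
  induction n with
  | zero => rw [D.p_zero]; exact one_pos
  | succ n ih => rw [D.p_succ]; exact Nat.mul_pos ih (by have := D.M_add_three_le_s n; omega)

lemma three_mul_p_le (n : ℕ) : 3 * D.p n ≤ D.p (n + 1) := by
  rw [D.p_succ, mul_comm]
  exact Nat.mul_le_mul_left _ (by have := D.M_add_three_le_s n; omega)

lemma lt_p (n : ℕ) : n < D.p n := by
  induction n with
  | zero => exact D.p_pos 0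
  | succ n ih => have := D.three_mul_p_le n; omega

lemma central_natAbs (k : ℤ) : D.Central k.natAbs k := by
  have h (n : ℕ) : (n : ℤ) ≤ D.offset n ∧ (n : ℤ) < D.p n - D.offset n := by
    induction n with
    | zero => simp [offset, D.p_zero]
    | succ n ih =>
      have h1 := D.p_pos n
      have h2 : 3 * (D.p n : ℤ) ≤ D.p (n + 1) := by exact_mod_cast D.three_mul_p_le n
      simp only [offset]
      push_cast
      omega
  have := h k.natAbs
  constructor <;> omega

lemma word_succ_block (n c : ℕ) {m i : ℕ} (hi : i < D.p n) :
    D.word (n + 1) c (m * D.p n + i) =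
      D.word n (if m < D.s n then m % D.M n else c / D.M n ^ (m - D.s n) % D.M n) i := by
  have h1 : (m * D.p n + i) / D.p n = m := by
    rw [mul_comm, Nat.mul_add_div (D.p_pos n), Nat.div_eq_of_lt hi, add_zero]
  have h2 : (m * D.p n + i) % D.p n = i := by
    rw [mul_comm, Nat.mul_add_mod, Nat.mod_eq_of_lt hi]
  rw [word, h1, h2]

lemma central_succ {n : ℕ} {k : ℤ} (h : D.Central n k) :
    D.Central (n + 1) k ∧ D.word (n + 1) 1 (k + D.offset (n + 1)).toNat =
      D.word n 1 (k + D.offset n).toNat := by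
  obtain ⟨h1, h2⟩ := h
  have h3 : 3 * (D.p n : ℤ) ≤ D.p (n + 1) := by exact_mod_cast D.three_mul_p_le n
  refine ⟨⟨?_, ?_⟩, ?_⟩
  · simp only [offset]; omega
  · simp only [offset]; omega
  · have : (k + D.offset (n + 1)).toNat = 1 * D.p n + (k + D.offset n).toNat := by
      simp only [offset]; omega
    rw [this, D.word_succ_block n 1 (by omega), if_pos (by have := D.M_add_three_le_s n; omega),
      Nat.mod_eq_of_lt (D.two_le_M n)]

lemma central_mono {n N : ℕ} (hn : n ≤ N) {k : ℤ} (h : D.Central n k) :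
    D.Central N k ∧ D.word N 1 (k + D.offset N).toNat = D.word n 1 (k + D.offset n).toNat := by
  induction N, hn using Nat.le_induction with
  | base => exact ⟨h, rfl⟩
  | succ N _ ih =>
    have := D.central_succ ih.1
    exact ⟨this.1, this.2.trans ih.2⟩

lemma seq_eq_word {n : ℕ} {k : ℤ} (h : D.Central n k) :
    D.seq k = D.word n 1 (k + D.offset n).toNat :=
  (D.central_mono (le_max_left k.natAbs n) (D.central_natAbs k)).2.symm.trans
    (D.central_mono (le_max_right k.natAbs n) h).2

lemma seq_eq_word_of_lt {n i : ℕ} (hi : i < D.p n) :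
    D.seq (-D.offset n + i) = D.word n 1 i := by
  have hz : -D.offset n + i + D.offset n = i := by ring
  rw [D.seq_eq_word (n := n) ⟨by omega, by omega⟩, hz, Int.toNat_natCast]

lemma p_dvd {n N : ℕ} (hn : n ≤ N) : D.p n ∣ D.p N := by
  induction N, hn using Nat.le_induction with
  | base => exact dvd_rfl
  | succ N _ ih => exact ih.trans (D.p_succ N ▸ dvd_mul_right _ _)

lemma exists_offset_eq {n N : ℕ} (hn : n ≤ N) : ∃ d : ℤ, D.offset N = D.offset n + d * D.p n := by
  induction N, hn using Nat.le_induction with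
  | base => exact ⟨0, by simp⟩
  | succ N h ih =>
    obtain ⟨d, hd⟩ := ih
    obtain ⟨q, hq⟩ := D.p_dvd h
    exact ⟨d + q, by simp only [offset, hd, hq]; push_cast; ring⟩

lemma exists_word_eq {n N : ℕ} (hn : n ≤ N) {c : ℕ} (hc : c < D.M N) {j : ℕ}
    (hj : j * D.p n < D.p N) :
    ∃ c' < D.M n, ∀ i < D.p n, D.word N c (j * D.p n + i) = D.word n c' i := by
  induction N, hn using Nat.le_induction generalizing c j with
  | base =>
    have : j = 0 := by
      by_contra h
      have := Nat.le_mul_of_pos_left (D.p n) (Nat.pos_of_ne_zero h)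
      omega
    subst this
    exact ⟨c, hc, fun i _ => by simp⟩
  | succ N h ih =>
    obtain ⟨q, hq⟩ := D.p_dvd h
    have hM : 0 < D.M N := by have := D.two_le_M N; omega
    have hq0 : 0 < q := Nat.pos_of_ne_zero fun h0 => by
      have := D.p_pos N
      rw [hq, h0] at this
      omega
    have hjq : j % q * D.p n < D.p N := by
      rw [hq, mul_comm]
      exact Nat.mul_lt_mul_of_pos_left (Nat.mod_lt _ hq0) (D.p_pos n)
    obtain ⟨c', hc', h'⟩ := ih (c := if j / q < D.s N then j / q % D.M N
      else c / D.M N ^ (j / q - D.s N) % D.M N) (by split_ifs <;> exact Nat.mod_lt _ hM) hjq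
    refine ⟨c', hc', fun i hi => ?_⟩
    rw [← h' i hi]
    have hlt : j % q * D.p n + i < D.p N := by
      have h1 : j % q + 1 ≤ q := Nat.mod_lt _ hq0
      have h2 := Nat.mul_le_mul_right (D.p n) h1
      rw [mul_comm q, ← hq, add_mul] at h2
      omega
    rw [← D.word_succ_block N c hlt, hq]
    congr 1
    have := Nat.div_add_mod j q
    conv_lhs => rw [← this]
    ring

lemma exists_block (n : ℕ) (m : ℤ) :
    ∃ c < D.M n, ∀ i < D.p n, D.seq (-D.offset n + m * D.p n + i) = D.word n c i := by
  set k : ℤ := -D.offset n + m * D.p n with hk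
  set N := max k.natAbs n
  have hN : D.Central N k := (D.central_mono (le_max_left _ _) (D.central_natAbs k)).1
  have hnN : n ≤ N := le_max_right _ _
  obtain ⟨d, hd⟩ := D.exists_offset_eq hnN
  obtain ⟨q, hq⟩ := D.p_dvd hnN
  have hkd : k + D.offset N = (m + d) * D.p n := by rw [hk, hd]; ring
  have hp : (0 : ℤ) < D.p n := by exact_mod_cast D.p_pos n
  obtain ⟨h1, h2⟩ := hN
  rw [hkd] at h1 h2
  obtain ⟨j, hj⟩ := Int.eq_ofNat_of_zero_le (nonneg_of_mul_nonneg_left h1 hp)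
  rw [hj] at hkd h2
  have hjp : j * D.p n < D.p N := by exact_mod_cast h2
  obtain ⟨c, hc, h⟩ := D.exists_word_eq hnN (c := 1) (D.two_le_M N) hjp
  refine ⟨c, hc, fun i hi => ?_⟩
  have hlt : j * D.p n + i < D.p N := by
    rw [hq, mul_comm] at hjp
    have h3 : j + 1 ≤ q := lt_of_mul_lt_mul_left hjp (Nat.zero_le _)
    have h4 := Nat.mul_le_mul_right (D.p n) h3
    rw [mul_comm q, ← hq, add_mul] at h4
    omega
  have : k + i = -D.offset N + ((j * D.p n + i : ℕ) : ℤ) := by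
    push_cast
    linear_combination hkd
  rw [this, D.seq_eq_word_of_lt hlt, h i hi]

theorem isToeplitz_seq : IsToeplitz D.seq := by
  intro k
  set n := k.natAbs
  obtain ⟨h1, h2⟩ : D.Central n k := D.central_natAbs k
  have key (m : ℤ) : D.seq (k + m * D.p (n + 1)) = D.word n 1 (k + D.offset n).toNat := by
    obtain ⟨c, -, h⟩ := D.exists_block (n + 1) m
    have hi : 1 * D.p n + (k + D.offset n).toNat < D.p (n + 1) := by
      have := D.three_mul_p_le n
      omega
    have := h _ hi
    rw [D.word_succ_block n c (by omega), if_pos (by have := D.M_add_three_le_s n; omega),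
      Nat.mod_eq_of_lt (D.two_le_M n)] at this
    rw [← this]
    congr 1
    push_cast
    rw [Int.toNat_of_nonneg h1]
    simp only [offset]
    ring
  refine ⟨D.p (n + 1), by exact_mod_cast D.p_pos (n + 1), fun m => ?_⟩
  rw [key m, ← key 0]
  simp

theorem wordGrowthLE_seq (n : ℕ) : WordGrowthLE D.seq (Real.log (D.M n) / D.p n) :=
  wordGrowthLE_of_blocks (D.p_pos n) (by have := D.two_le_M n; omega) (-D.offset n) (D.word n)
    (D.exists_block n)

lemma word_injective (n : ℕ) {c d : ℕ} (hc : c < D.M n) (hd : d < D.M n)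
    (h : ∀ i < D.p n, D.word n c i = D.word n d i) : c = d := by
  induction n generalizing c d with
  | zero =>
    rw [D.M_zero] at hc hd
    have := congrArg Fin.val (h 0 (D.p_pos 0))
    simpa only [word, Fin.ofNat, Nat.mod_eq_of_lt hc, Nat.mod_eq_of_lt hd] using this
  | succ n ih =>
    have hM : 0 < D.M n := by have := D.two_le_M n; omega
    rw [D.M_succ] at hc hd
    refine Nat.eq_of_forall_div_pow_mod_eq _ hc hd fun j hj => ?_
    refine ih (Nat.mod_lt _ hM) (Nat.mod_lt _ hM) fun i hi => ?_
    have hlt : (D.s n + j) * D.p n + i < D.p (n + 1) := by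
      have h1 := Nat.mul_le_mul_right (D.p n) (show D.s n + j + 1 ≤ D.s n + D.u n by omega)
      rw [add_mul _ 1, one_mul] at h1
      rw [D.p_succ, mul_comm (D.p n)]
      omega
    simpa [D.word_succ_block n _ hi] using h _ hlt

theorem wordGrowthGE_seq {t : ℝ} (ht : ∀ n, t ≤ Real.log (D.M n) / D.p n) :
    WordGrowthGE D.seq t := by
  classical
  have htop : Tendsto D.p atTop atTop :=
    tendsto_atTop_mono (fun n => (D.lt_p n).le) tendsto_id
  refine htop.frequently (Frequently.of_forall fun n => ?_)
  have hM := D.two_le_M n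
  have hp : (0 : ℝ) < D.p n := by exact_mod_cast D.p_pos n
  let pos (c : ℕ) : ℤ := -D.offset (n + 1) + ((c * D.p n : ℕ) : ℤ)
  have hinj : Function.Injective pos := fun c d hcd => by
    have : c * D.p n = d * D.p n := by simpa [pos] using hcd
    exact Nat.eq_of_mul_eq_mul_right (D.p_pos n) this
  have hword (c : ℕ) (hc : c < D.M n) (i : ℕ) (hi : i < D.p n) :
      D.seq (pos c + i) = D.word n c i := by
    have hs := D.M_add_three_le_s n
    have hlt : c * D.p n + i < D.p (n + 1) := by
      have h1 := Nat.mul_le_mul_right (D.p n) (show c + 1 ≤ D.s n + D.u n by omega)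
      rw [add_mul _ 1, one_mul] at h1
      rw [D.p_succ, mul_comm (D.p n)]
      omega
    have h2 : pos c + i = -D.offset (n + 1) + ((c * D.p n + i : ℕ) : ℤ) := by
      simp only [pos]; push_cast; ring
    rw [h2, D.seq_eq_word_of_lt hlt, D.word_succ_block n 1 hi, if_pos (by omega),
      Nat.mod_eq_of_lt hc]
  refine ⟨(Finset.range (D.M n)).image pos, ?_, ?_⟩
  · rw [Finset.card_image_of_injective _ hinj, Finset.card_range]
    have h1 : t * D.p n ≤ Real.log (D.M n) := (le_div_iff₀ hp).mp (ht n)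
    calc Real.exp (t * D.p n) ≤ Real.exp (Real.log (D.M n)) := Real.exp_le_exp.mpr h1
      _ = D.M n := Real.exp_log (by exact_mod_cast (by omega : 0 < D.M n))
  · simp only [Finset.mem_image, Finset.mem_range]
    rintro _ ⟨c, hc, rfl⟩ _ ⟨d, hd, rfl⟩ h
    rw [D.word_injective n hc hd fun i hi => by rw [← hword c hc i hi, ← hword d hd i hi, h i hi]]

end BlockHierarchy

theorem exists_rate_between {t ε : ℝ} (ht : 0 ≤ t) (hε : 0 < ε) {p M : ℕ} (hp : 0 < p)
    (hM : 2 ≤ M) (h : t < Real.log M / p) :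
    ∃ s u : ℕ, M + 3 ≤ s ∧ 0 < u ∧ t < Real.log ((M ^ u : ℕ) : ℝ) / ((p * (s + u) : ℕ) : ℝ) ∧
      Real.log ((M ^ u : ℕ) : ℝ) / ((p * (s + u) : ℕ) : ℝ) < t + ε := by
  have hp' : (0 : ℝ) < p := by exact_mod_cast hp
  have hL : 0 < Real.log M := Real.log_pos (by exact_mod_cast hM)
  have hr : 0 < Real.log M / p := div_pos hL hp'
  obtain ⟨q, hq1, hq2⟩ := exists_rat_btwn
    (show t / (Real.log M / p) < min 1 ((t + ε) / (Real.log M / p)) from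
      lt_min ((div_lt_one hr).mpr h) (by gcongr; linarith))
  have hq0 : (0 : ℝ) < q := (div_nonneg ht hr.le).trans_lt hq1
  have hq0' : 0 < q := by exact_mod_cast hq0
  have hqlt : q < 1 := by exact_mod_cast hq2.trans_le (min_le_left _ _)
  have hnum : 0 < q.num := Rat.num_pos.mpr hq0'
  have hlt : q.num < q.den := Rat.num_lt_denom_iff.mpr hqlt
  obtain ⟨a, ha⟩ : ∃ a : ℕ, q.num = a := ⟨q.num.toNat, by omega⟩
  obtain ⟨c, hc⟩ : ∃ c : ℕ, q.den = a + c := ⟨q.den - a, by omega⟩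
  have hqa : (q : ℝ) = a / (a + c) := by
    rw [Rat.cast_def, ha, hc]; push_cast; rfl
  have ha0 : 0 < a := by omega
  have hc0 : 0 < c := by omega
  have hval : Real.log ((M ^ (a * (M + 3)) : ℕ) : ℝ) /
      ((p * (c * (M + 3) + a * (M + 3)) : ℕ) : ℝ) = q * (Real.log M / p) := by
    rw [hqa]
    push_cast
    rw [Real.log_pow]
    have : (0 : ℝ) < a := by exact_mod_cast ha0
    push_cast
    field_simp
    ring
  refine ⟨c * (M + 3), a * (M + 3), Nat.le_mul_of_pos_left _ hc0, by positivity, ?_, ?_⟩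
  · rw [hval]
    exact (div_lt_iff₀ hr).mp hq1
  · rw [hval]
    exact (lt_div_iff₀ hr).mp (hq2.trans_le (min_le_right _ _))

theorem BlockHierarchy.exists_tendsto {t : ℝ} (ht : 0 ≤ t) :
    ∃ (A : ℕ) (D : BlockHierarchy A), (∀ n, t ≤ Real.log (D.M n) / D.p n) ∧
      Tendsto (fun n => Real.log (D.M n) / D.p n) atTop (𝓝 t) := by
  let State := {z : ℕ × ℕ // 0 < z.1 ∧ 2 ≤ z.2 ∧ t < Real.log z.2 / z.1}
  have hstep (z : State) (n : ℕ) := exists_rate_between ht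
    (show (0 : ℝ) < 1 / (n + 1) by positivity) z.2.1 z.2.2.1 z.2.2.2
  choose s u hs hu hlt hε using hstep
  obtain ⟨A, hA⟩ := exists_nat_gt (Real.exp t)
  have hA1 : (1 : ℝ) < A := (Real.one_le_exp ht).trans_lt hA
  have hA1' : 1 < A := by exact_mod_cast hA1
  let z₀ : State := ⟨(1, A + 1), one_pos, by omega, by
    rw [Nat.cast_one, div_one, Real.lt_log_iff_exp_lt (by positivity)]
    push_cast
    linarith⟩
  let f (n : ℕ) (z : State) : State := ⟨(z.1.1 * (s z n + u z n), z.1.2 ^ u z n),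
    Nat.mul_pos z.2.1 (Nat.add_pos_right _ (hu z n)),
    z.2.2.1.trans (Nat.le_self_pow (hu z n).ne' _), hlt z n⟩
  let Z (n : ℕ) : State := Nat.rec z₀ f n
  refine ⟨A, ⟨fun n => (Z n).1.1, fun n => (Z n).1.2, fun n => s (Z n) n, fun n => u (Z n) n, rfl,
    rfl, fun _ => rfl, fun _ => rfl, fun n => (Z n).2.2.1, fun n => hs _ _⟩,
    fun n => (Z n).2.2.2.le, ?_⟩
  rw [← tendsto_add_atTop_iff_nat 1]
  have h1 : Tendsto (fun n : ℕ => t + 1 / ((n : ℝ) + 1)) atTop (𝓝 t) := by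
    simpa using tendsto_const_nhds.add (tendsto_one_div_add_atTop_nhds_zero_nat (𝕜 := ℝ))
  exact tendsto_of_tendsto_of_tendsto_of_le_of_le tendsto_const_nhds h1
    (fun n => (Z (n + 1)).2.2.2.le) fun n => (hε (Z n) n).le

/-- The binary digit of `α` with weight `2 ^ (-(v + 1))`. -/
noncomputable def binDigit (α : ℝ) (v : ℕ) : Bool :=
  decide (⌊2 ^ (v + 1) * α⌋ = 2 * ⌊2 ^ v * α⌋ + 1)

/-- The `2`-adic Toeplitz sequence in which `true` has frequency `α`: its value on the positions
`k` for which `3 * k + 1` has `2`-adic valuation `v` is the binary digit of `α` with index `v`. The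
centre `-1 / 3` is chosen so that no integer position is left undetermined. -/
noncomputable def digitSeq (α : ℝ) (k : ℤ) : Bool := binDigit α (padicValInt 2 (3 * k + 1))

lemma floor_two_pow_succ_mul (α : ℝ) (j : ℕ) :
    ⌊2 ^ (j + 1) * α⌋ = 2 * ⌊2 ^ j * α⌋ + (binDigit α j).toNat := by
  have h1 := Int.floor_le (2 ^ j * α)
  have h2 := Int.lt_floor_add_one (2 ^ j * α)
  have h3 : (2 : ℝ) ^ (j + 1) * α = 2 * (2 ^ j * α) := by ring
  have h4 : 2 * ⌊2 ^ j * α⌋ ≤ ⌊2 ^ (j + 1) * α⌋ := by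
    rw [Int.le_floor, h3]; push_cast; linarith
  have h5 : ⌊2 ^ (j + 1) * α⌋ < 2 * ⌊2 ^ j * α⌋ + 2 := by
    rw [Int.floor_lt, h3]; push_cast; linarith
  by_cases h : ⌊2 ^ (j + 1) * α⌋ = 2 * ⌊2 ^ j * α⌋ + 1
  · simp [binDigit, h]
  · simp only [binDigit, h, decide_false, Bool.toNat_false, Nat.cast_zero]
    omega

lemma two_pow_dvd_three_mul_add_one_iff (j : ℕ) (k : ℤ) :
    (2 : ℤ) ^ j ∣ 3 * k + 1 ↔ j ≤ padicValInt 2 (3 * k + 1) := by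
  have := padicValInt_dvd_iff (p := 2) j (3 * k + 1)
  rw [Nat.cast_ofNat] at this
  rw [this, or_iff_right (by omega)]

lemma two_pow_dvd_three_mul_add_iff (j : ℕ) (k d : ℤ) (hd : (2 : ℤ) ^ j ∣ d) :
    (2 : ℤ) ^ j ∣ 3 * (k + d) + 1 ↔ (2 : ℤ) ^ j ∣ 3 * k + 1 := by
  rw [show 3 * (k + d) + 1 = (3 * k + 1) + 3 * d by ring]
  exact (Int.dvd_add_left (hd.mul_left 3))

lemma padicValInt_add_eq {j : ℕ} {k d : ℤ} (hk : ¬ (2 : ℤ) ^ j ∣ 3 * k + 1)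
    (hd : (2 : ℤ) ^ j ∣ d) :
    padicValInt 2 (3 * (k + d) + 1) = padicValInt 2 (3 * k + 1) := by
  have hk' : ¬ (2 : ℤ) ^ j ∣ 3 * (k + d) + 1 := by
    rwa [two_pow_dvd_three_mul_add_iff j k d hd]
  rw [two_pow_dvd_three_mul_add_one_iff, not_le] at hk hk'
  refine le_antisymm ?_ ?_
  · rw [← two_pow_dvd_three_mul_add_one_iff,
      ← two_pow_dvd_three_mul_add_iff _ k d ((pow_dvd_pow 2 hk'.le).trans hd),
      two_pow_dvd_three_mul_add_one_iff]
  · rw [← two_pow_dvd_three_mul_add_one_iff,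
      two_pow_dvd_three_mul_add_iff _ k d ((pow_dvd_pow 2 hk.le).trans hd),
      two_pow_dvd_three_mul_add_one_iff]

lemma digitSeq_add_eq (α : ℝ) {j : ℕ} {k d : ℤ} (hk : ¬ (2 : ℤ) ^ j ∣ 3 * k + 1)
    (hd : (2 : ℤ) ^ j ∣ d) : digitSeq α (k + d) = digitSeq α k := by
  rw [digitSeq, padicValInt_add_eq hk hd, digitSeq]

theorem isToeplitz_digitSeq (α : ℝ) : IsToeplitz (digitSeq α) := fun n =>
  ⟨2 ^ (padicValInt 2 (3 * n + 1) + 1), one_le_pow₀ one_le_two, fun m =>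
    digitSeq_add_eq α (by rw [two_pow_dvd_three_mul_add_one_iff]; omega) (dvd_mul_left _ _)⟩

lemma two_pow_dvd_sub {j : ℕ} {k l : ℤ} (hk : (2 : ℤ) ^ j ∣ 3 * k + 1)
    (hl : (2 : ℤ) ^ j ∣ 3 * l + 1) : (2 : ℤ) ^ j ∣ l - k := by
  have h : (2 : ℤ) ^ j ∣ 3 * (l - k) := by
    have := dvd_sub hl hk
    rwa [show 3 * l + 1 - (3 * k + 1) = 3 * (l - k) by ring] at this
  have hcop : IsCoprime (2 : ℤ) 3 := ⟨-1, 1, by norm_num⟩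
  exact hcop.pow_left.dvd_of_dvd_mul_left h

/-- In every window of length `2 ^ j` there are `⌊2 ^ j * α⌋` positions with value `true`,
apart from one position whose value depends on higher digits. -/
theorem exists_sum_digitSeq_eq {α : ℝ} (h0 : 0 ≤ α) (h1 : α < 1) (j : ℕ) (k : ℤ) :
    ∃ h : ℤ, (2 : ℤ) ^ j ∣ 3 * h + 1 ∧ k ≤ h ∧ h < k + 2 ^ j ∧
      ∑ i ∈ Finset.range (2 ^ j), ((digitSeq α (k + i)).toNat : ℤ) =
        ⌊2 ^ j * α⌋ + (digitSeq α h).toNat := by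
  induction j generalizing k with
  | zero =>
    refine ⟨k, by simp, le_rfl, by simp, ?_⟩
    have : ⌊α⌋ = 0 := Int.floor_eq_zero_iff.mpr ⟨h0, h1⟩
    simp [this]
  | succ j ih =>
    obtain ⟨a, ha, hka, hak, hsa⟩ := ih k
    obtain ⟨b, hb, hkb, hbk, hsb⟩ := ih (k + 2 ^ j)
    have hpos : (0 : ℤ) < 2 ^ j := by positivity
    have hab : b = a + 2 ^ j := by
      obtain ⟨c, hc⟩ := two_pow_dvd_sub ha hb
      have hc0 : 0 < c := by
        by_contra! hneg
        nlinarith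
      have hc2 : c < 2 := by
        by_contra! hneg
        nlinarith
      obtain rfl : c = 1 := by omega
      linarith
    have hsum : ∑ i ∈ Finset.range (2 ^ (j + 1)), ((digitSeq α (k + i)).toNat : ℤ) =
        2 * ⌊2 ^ j * α⌋ + (digitSeq α a).toNat + (digitSeq α b).toNat := by
      rw [pow_succ, mul_two, Finset.sum_range_add, hsa]
      have : ∀ i : ℕ, k + ((2 ^ j + i : ℕ) : ℤ) = k + 2 ^ j + i := fun i => by push_cast; ring
      simp only [this, hsb]
      ring
    have hval {h : ℤ} (hh : (2 : ℤ) ^ j ∣ 3 * h + 1) (hh' : ¬ (2 : ℤ) ^ (j + 1) ∣ 3 * h + 1) :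
        digitSeq α h = binDigit α j := by
      rw [two_pow_dvd_three_mul_add_one_iff] at hh hh'
      rw [digitSeq, show padicValInt 2 (3 * h + 1) = j by omega]
    obtain ⟨x, hx⟩ := ha
    have hbx : 3 * b + 1 = 2 ^ j * (x + 3) := by rw [hab]; linarith
    have hdvd (y : ℤ) : (2 : ℤ) ^ (j + 1) ∣ 2 ^ j * y ↔ Even y := by
      rw [pow_succ, mul_dvd_mul_iff_left hpos.ne', even_iff_two_dvd]
    rw [hsum, floor_two_pow_succ_mul, pow_succ]
    rcases Int.even_or_odd x with hev | hodd
    · refine ⟨a, ?_, hka, by linarith, ?_⟩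
      · rw [← pow_succ, hx, hdvd]; exact hev
      · rw [hval hb (by rw [hbx, hdvd]; grind)]
        ring
    · refine ⟨b, ?_, by linarith, by linarith, ?_⟩
      · rw [← pow_succ, hbx, hdvd]; grind
      · rw [hval ⟨x, hx⟩ (by rw [hx, hdvd]; grind)]

theorem wordGrowthLE_digitSeq {α : ℝ} (h0 : 0 ≤ α) (h1 : α < 1) (j : ℕ) :
    WordGrowthLE (digitSeq α) (Real.log 2 / 2 ^ j) := by
  have := wordGrowthLE_of_blocks (x := digitSeq α) (p := 2 ^ j) (M := 2) (by positivity) two_pos 0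
    (fun c i => if (2 : ℤ) ^ j ∣ 3 * i + 1 then decide (c = 1) else digitSeq α i) fun m => by
      obtain ⟨h, hh, hmh, hhm, -⟩ := exists_sum_digitSeq_eq h0 h1 j (m * 2 ^ j)
      refine ⟨(digitSeq α h).toNat, Bool.toNat_lt _, fun i hi => ?_⟩
      have hd : (2 : ℤ) ^ j ∣ m * 2 ^ j := dvd_mul_left _ _
      have he : 0 + m * ((2 ^ j : ℕ) : ℤ) + i = i + m * 2 ^ j := by push_cast; ring
      rw [he]
      split_ifs with hi'
      · have hi'' := (two_pow_dvd_three_mul_add_iff j i _ hd).mpr hi'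
        have hi3 : (i : ℤ) < 2 ^ j := by exact_mod_cast hi
        have : (i : ℤ) + m * 2 ^ j = h := by
          obtain ⟨c, hc⟩ := two_pow_dvd_sub hi'' hh
          have hpos : (0 : ℤ) < 2 ^ j := by positivity
          have hc0 : -1 < c := by
            by_contra! hneg
            nlinarith
          have hc2 : c < 1 := by
            by_contra! hneg
            nlinarith
          obtain rfl : c = 0 := by omega
          linarith
        rw [this]
        cases digitSeq α h <;> simp
      · exact digitSeq_add_eq α hi' hd
  simpa using this

lemma exists_padicValInt_eq (v : ℕ) : ∃ k : ℤ, padicValInt 2 (3 * k + 1) = v := by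
  obtain ⟨h, ⟨x, hx⟩, -⟩ := exists_sum_digitSeq_eq le_rfl one_pos v 0
  have key (l y : ℤ) (hy : 3 * l + 1 = 2 ^ v * y) (hodd : ¬ Even y) :
      padicValInt 2 (3 * l + 1) = v := by
    have h1 := (two_pow_dvd_three_mul_add_one_iff v l).mp ⟨y, hy⟩
    have h2 : ¬ (2 : ℤ) ^ (v + 1) ∣ 3 * l + 1 := by
      rw [hy, pow_succ, mul_dvd_mul_iff_left (by positivity), ← even_iff_two_dvd]
      exact hodd
    rw [two_pow_dvd_three_mul_add_one_iff] at h2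
    omega
  by_cases hev : Even x
  · exact ⟨h + 2 ^ v, key _ (x + 3) (by linarith) (by grind)⟩
  · exact ⟨h, key _ x hx hev⟩

theorem isNonperiodic_digitSeq {α : ℝ} (hα : Irrational α) : IsNonperiodic (digitSeq α) := by
  rintro ⟨p, hp, hper⟩
  obtain ⟨e, q, hq, rfl⟩ : ∃ (e : ℕ) (q : ℤ), ¬ 2 ∣ q ∧ p = 2 ^ e * q := by
    have hfin : FiniteMultiplicity (2 : ℤ) p := Int.finiteMultiplicity_iff.mpr ⟨by simp, by omega⟩
    obtain ⟨q, hpq, hq⟩ := hfin.exists_eq_pow_mul_and_not_dvd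
    exact ⟨_, q, hq, hpq⟩
  have hconst (v : ℕ) (hv : e + 1 ≤ v) : binDigit α v = binDigit α e := by
    obtain ⟨k, hk⟩ := exists_padicValInt_eq v
    have hk' : (2 : ℤ) ^ (e + 1) ∣ 3 * k + 1 := by
      rwa [two_pow_dvd_three_mul_add_one_iff, hk]
    have hge : (2 : ℤ) ^ e ∣ 3 * (k + 2 ^ e * q) + 1 := by
      rw [two_pow_dvd_three_mul_add_iff _ _ _ (dvd_mul_right _ _)]
      exact (pow_dvd_pow 2 e.le_succ).trans hk'
    have hlt : ¬ (2 : ℤ) ^ (e + 1) ∣ 3 * (k + 2 ^ e * q) + 1 := fun h => by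
      have := two_pow_dvd_sub hk' h
      rw [add_sub_cancel_left, pow_succ, mul_dvd_mul_iff_left (by positivity)] at this
      exact hq this
    rw [two_pow_dvd_three_mul_add_one_iff] at hge hlt
    have := hper k
    rwa [digitSeq, digitSeq, hk, show padicValInt 2 (3 * (k + 2 ^ e * q) + 1) = e by omega,
      eq_comm] at this
  have hfl (n : ℕ) : ⌊2 ^ (e + 1 + n) * α⌋ + (binDigit α e).toNat =
      2 ^ n * (⌊2 ^ (e + 1) * α⌋ + (binDigit α e).toNat) := by
    induction n with
    | zero => simp
    | succ n ih =>
      rw [← add_assoc, floor_two_pow_succ_mul, hconst _ (by omega), pow_succ]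
      linarith
  set c : ℤ := ((binDigit α e).toNat : ℤ) with hc
  have hc0 : 0 ≤ c := by positivity
  have hc1 : c ≤ 1 := by
    have := Bool.toNat_lt (binDigit α e)
    omega
  set N : ℤ := ⌊2 ^ (e + 1) * α⌋ + c with hN
  have hbound (n : ℕ) : |2 ^ (e + 1) * α - N| ≤ (1 / 2) ^ n := by
    have h2 : (0 : ℝ) < 2 ^ n := by positivity
    have h3 : (⌊2 ^ (e + 1 + n) * α⌋ : ℝ) + c = 2 ^ n * N := by exact_mod_cast hfl n
    have h4 := Int.floor_le (2 ^ (e + 1 + n) * α)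
    have h5 := Int.lt_floor_add_one (2 ^ (e + 1 + n) * α)
    have hc0' : (0 : ℝ) ≤ c := by exact_mod_cast hc0
    have hc1' : (c : ℝ) ≤ 1 := by exact_mod_cast hc1
    have h6 : 2 ^ (e + 1 + n) * α = 2 ^ n * (2 ^ (e + 1) * α) := by ring
    rw [div_pow, one_pow, le_div_iff₀ h2, ← abs_of_pos h2, ← abs_mul, abs_le]
    constructor <;> nlinarith
  have hzero : 2 ^ (e + 1) * α - N = 0 := abs_nonpos_iff.mp
    (ge_of_tendsto' (tendsto_pow_atTop_nhds_zero_of_lt_one (by norm_num) (by norm_num)) hbound)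
  refine hα ⟨(N : ℚ) / 2 ^ (e + 1), ?_⟩
  push_cast
  rw [div_eq_iff (by positivity)]
  linarith

theorem measureReal_eq_of_abs_sum_indicator_sub_le {X : Type*} [MeasurableSpace X] {μ : Measure X}
    [IsProbabilityMeasure μ] {T : X → X} (hT : MeasurePreserving T μ μ) {U : Set X}
    (hU : MeasurableSet U) {α : ℝ}
    (h : ∀ (j : ℕ) (x : X),
      |∑ i ∈ Finset.range (2 ^ j), U.indicator (fun _ => (1 : ℝ)) (T^[i] x) - 2 ^ j * α| ≤ 1) :
    μ.real U = α := by
  have hmeas (i : ℕ) : MeasurableSet (T^[i] ⁻¹' U) := (hT.iterate i).measurable hU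
  have hind (i : ℕ) : (fun x => U.indicator (fun _ => (1 : ℝ)) (T^[i] x)) =
      (T^[i] ⁻¹' U).indicator fun _ => 1 := rfl
  have hinteg (i : ℕ) : Integrable (fun x => U.indicator (fun _ => (1 : ℝ)) (T^[i] x)) μ := by
    rw [hind]
    exact (integrable_const 1).indicator (hmeas i)
  have hval (i : ℕ) : ∫ x, U.indicator (fun _ => (1 : ℝ)) (T^[i] x) ∂μ = μ.real U := by
    rw [hind, integral_indicator_const _ (hmeas i), smul_eq_mul, mul_one, measureReal_def,
      (hT.iterate i).measure_preimage hU.nullMeasurableSet, measureReal_def]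
  have hbound (j : ℕ) : |μ.real U - α| ≤ (1 / 2) ^ j := by
    have h1 := norm_integral_le_of_norm_le_const (μ := μ)
      (Eventually.of_forall fun x => (Real.norm_eq_abs _).trans_le (h j x))
    rw [integral_sub (integrable_finsetSum _ fun i _ => hinteg i) (integrable_const _),
      integral_finsetSum _ fun i _ => hinteg i] at h1
    simp only [hval, Finset.sum_const, Finset.card_range, nsmul_eq_mul, integral_const,
      probReal_univ, smul_eq_mul, one_mul, mul_one, Real.norm_eq_abs] at h1
    have h2 : (0 : ℝ) < 2 ^ j := by positivity
    push_cast at h1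
    rw [← mul_sub, abs_mul, abs_of_pos h2] at h1
    rwa [div_pow, one_pow, le_div_iff₀ h2, mul_comm]
  exact sub_eq_zero.mp (abs_nonpos_iff.mp
    (ge_of_tendsto' (tendsto_pow_atTop_nhds_zero_of_lt_one (by norm_num) (by norm_num)) hbound))

namespace ToeplitzFlow

variable (F : ToeplitzFlow)

instance : CompactSpace F.X := isCompact_iff_compactSpace.mp isClosed_closure.isCompact

theorem mem_clopenValues {α : ℝ} (g : F.Λ → Bool)
    (h : ∀ (j : ℕ) (k : ℤ),
      |∑ i ∈ Finset.range (2 ^ j), ((g (F.η (k + i))).toNat : ℝ) - 2 ^ j * α| ≤ 1) :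
    ENNReal.ofReal α ∈ clopenValues F.T := by
  have hcont : Continuous fun x : F.X => g (x.1 0) :=
    continuous_of_discreteTopology.comp ((continuous_apply 0).comp continuous_subtype_val)
  have hU : IsClopen {x : F.X | g (x.1 0) = true} := (isClopen_discrete {true}).preimage hcont
  refine ⟨_, hU, ?_⟩
  let _ : MeasurableSpace F.X := borel F.X
  have : BorelSpace F.X := ⟨rfl⟩
  intro μ hμ hT
  suffices hreal : μ.real {x : F.X | g (x.1 0) = true} = α by rw [← hreal, ofReal_measureReal]
  refine measureReal_eq_of_abs_sum_indicator_sub_le ⟨F.T.continuous.measurable, hT⟩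
    hU.isOpen.measurableSet fun j x => ?_
  obtain ⟨k, hk⟩ := F.exists_agree x 0 (2 ^ j)
  convert h j k using 4 with i hi
  rw [← hk i (Finset.mem_range.mp hi)]
  simp only [Set.indicator_apply, Set.mem_ofPred_eq, T_iterate_apply]
  cases g (x.1 (0 + i)) <;> simp

end ToeplitzFlow

theorem exists_toeplitzFlow {t α : ℝ} (ht : 0 ≤ t) (hα : Irrational α) (h0 : 0 ≤ α) (h1 : α < 1) :
    ∃ F : ToeplitzFlow, F.entropy = t ∧ ENNReal.ofReal α ∈ clopenValues F.T := by
  obtain ⟨A, D, hle, hlim⟩ := BlockHierarchy.exists_tendsto ht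
  let F : ToeplitzFlow :=
    { Λ := Fin (A + 1) × Bool
      η := fun k => (D.seq k, digitSeq α k)
      toeplitz := D.isToeplitz_seq.prodMk (isToeplitz_digitSeq α)
      nonperiodic := IsNonperiodic.prodMk _ (isNonperiodic_digitSeq hα) }
  refine ⟨F, le_antisymm ?_ (F.le_entropy ((D.wordGrowthGE_seq hle).prodMk _)),
    F.mem_clopenValues (fun z : Fin (A + 1) × Bool => z.2) fun j k => ?_⟩
  · have hlim' : Tendsto (fun n => ((Real.log (D.M n) / D.p n + Real.log 2 / 2 ^ n : ℝ) : EReal))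
        atTop (𝓝 (t : EReal)) := by
      refine (continuous_coe_real_ereal.tendsto t).comp ?_
      have := (tendsto_pow_atTop_nhds_zero_of_lt_one (r := (1 / 2 : ℝ)) (by norm_num)
        (by norm_num)).const_mul (Real.log 2)
      simpa [div_eq_mul_inv] using hlim.add this
    exact ge_of_tendsto' hlim' fun n =>
      F.entropy_le ((D.wordGrowthLE_seq n).prodMk (wordGrowthLE_digitSeq h0 h1 n))
  · obtain ⟨h, -, -, -, hs⟩ := exists_sum_digitSeq_eq h0 h1 j k
    have hs' : ∑ i ∈ Finset.range (2 ^ j), ((digitSeq α (k + i)).toNat : ℝ) =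
        ⌊2 ^ j * α⌋ + (digitSeq α h).toNat := by exact_mod_cast hs
    change |∑ i ∈ Finset.range (2 ^ j), ((digitSeq α (k + i)).toNat : ℝ) - 2 ^ j * α| ≤ 1
    have h4 := Int.floor_le (2 ^ j * α)
    have h5 := Int.lt_floor_add_one (2 ^ j * α)
    have h6 : ((digitSeq α h).toNat : ℝ) ≤ 1 := by
      exact_mod_cast Nat.lt_succ_iff.mp (Bool.toNat_lt (digitSeq α h))
    have h7 : (0 : ℝ) ≤ (digitSeq α h).toNat := by positivity
    rw [hs', abs_le]
    constructor <;> linarith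

theorem not_countable_irrational_Ioo : ¬ {α : ℝ | Irrational α ∧ 0 < α ∧ α < 1}.Countable := by
  intro h
  have h2 : (Set.Ioo (0 : ℝ) 1).Countable :=
    (h.union (Set.countable_range ((↑) : ℚ → ℝ))).mono fun x hx => by
      by_cases hq : Irrational x
      · exact Or.inl ⟨hq, hx.1, hx.2⟩
      · exact Or.inr (not_not.mp hq)
  have := Cardinal.mk_Ioo_real (zero_lt_one (α := ℝ))
  rw [← Cardinal.le_aleph0_iff_set_countable, this] at h2
  exact Cardinal.aleph0_lt_continuum.not_ge h2

/-- for every `t ∈ [0, ∞)` there is an uncountable family of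
pairwise non-orbit-equivalent Toeplitz flows, all of topological entropy `t`. -/
theorem uncountably_many_non_orbit_equivalent_toeplitz_flows
    (t : ℝ) (ht : 0 ≤ t) :
    ∃ (I : Type) (Fam : I → ToeplitzFlow),
      ¬ Countable I ∧
      (∀ i : I, (Fam i).entropy = (t : EReal)) ∧
      (∀ i j : I, i ≠ j → ¬ OrbitEquiv (Fam i).T (Fam j).T) := by
  have key (α : {α : ℝ | Irrational α ∧ 0 < α ∧ α < 1}) :=
    exists_toeplitzFlow ht α.2.1 α.2.2.1.le α.2.2.2
  choose F hent hval using key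
  let V (α : {α : ℝ | Irrational α ∧ 0 < α ∧ α < 1}) : Set ENNReal := clopenValues (F α).T
  refine ⟨Set.range V, fun i => F i.2.choose, fun hc => ?_, fun i => hent _, fun i j hij hoe => ?_⟩
  · have hsU : (⋃ i : Set.range V, i.1).Countable := Set.countable_iUnion fun i => by
      obtain ⟨_, α, rfl⟩ := i
      exact countable_clopenValues (F α).T
    have hmaps : Set.MapsTo ENNReal.ofReal {α : ℝ | Irrational α ∧ 0 < α ∧ α < 1}
        (⋃ i : Set.range V, i.1) := fun α hα =>
      Set.mem_iUnion.mpr ⟨⟨V ⟨α, hα⟩, ⟨α, hα⟩, rfl⟩, hval ⟨α, hα⟩⟩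
    refine not_countable_irrational_Ioo (hmaps.countable_of_injOn (fun a ha b hb hab => ?_) hsU)
    exact (ENNReal.ofReal_eq_ofReal_iff ha.2.1.le hb.2.1.le).mp hab
  · refine hij (Subtype.ext ?_)
    rw [← i.2.choose_spec, ← j.2.choose_spec]
    exact hoe.clopenValues_eq
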